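/- arXiv:1408.4192 — 7 statements merged into one kernel-verified Lean document; each statement's English description precedes it below -/
import Mathlib

section
/- Let λ1, λ2, μ1 > 0 and let y ∈ [0,1). Set λ = λ1+λ2, Δ(y) = (λ+μ1−λ2·y)² − 4·λ1·μ1, x1(y) = ((λ+μ1−λ2·y) − √Δ(y))/(2·λ1), and x2(y) = ((λ+μ1−λ2·y) + √Δ(y))/(2·λ1). Then Δ(y) > 0, the inequalities 0 < x1(y) < 1 < x2(y) hold, and for every real x ≠ 0 one has x·K(x,y) = −λ1·(x − x1(y))·(x − x2(y)), where K(x,y) = λ1(1−x) + λ2(1−y) + μ1(1−1/x). In particular, α(y) := x1(y) is the unique zero of x ↦ x·K(x,y) in the interval [0,1]. -/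
open Real Filter Topology Set

noncomputable section

/-- The kernel discriminant Δ(y) = (λ+μ1−λ2·y)² − 4λ1μ1 with λ = λ1+λ2. -/
def Delta (l1 l2 m1 y : ℝ) : ℝ := (l1 + l2 + m1 - l2 * y) ^ 2 - 4 * l1 * m1

/-- The small kernel root α(y) = x1(y). -/
def alphaf (l1 l2 m1 y : ℝ) : ℝ :=
  (l1 + l2 + m1 - l2 * y - Real.sqrt (Delta l1 l2 m1 y)) / (2 * l1)

/-- The large kernel root x2(y). -/
def x2f (l1 l2 m1 y : ℝ) : ℝ :=
  (l1 + l2 + m1 - l2 * y + Real.sqrt (Delta l1 l2 m1 y)) / (2 * l1)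

/-- The kernel K(x,y) = λ1(1−x) + λ2(1−y) + μ1(1−1/x). -/
def Kker (l1 l2 m1 x y : ℝ) : ℝ :=
  l1 * (1 - x) + l2 * (1 - y) + m1 * (1 - 1 / x)

/-- A(y) = y·a(y) = λ1·y + λ2·y(1−y) + μ2·(y−1). -/
def Afun (l1 l2 m2 y : ℝ) : ℝ := l1 * y + l2 * y * (1 - y) + m2 * (y - 1)

/-- β(y) = H(y)/H(1) where H(y) = Σ_{k<N} (r2·y)^k and r2 = λ2/(λ1+λ2). -/
def betaf (l1 l2 : ℝ) (N : ℕ) (y : ℝ) : ℝ :=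
  (∑ k ∈ Finset.range N, (l2 / (l1 + l2) * y) ^ k) /
    (∑ k ∈ Finset.range N, (l2 / (l1 + l2) * 1) ^ k)

/-- L3(y) = β(y)(1−ρ1−ρ2). -/
def L3f (l1 l2 m1 m2 : ℝ) (N : ℕ) (y : ℝ) : ℝ :=
  betaf l1 l2 N y * (1 - l1 / m1 - l2 / m2)

/-- L2(y) = [λ1(α(y)−1)+λ2(y−1)]·L3(y)/(A(y)−λ1·y·α(y)). -/
def L2f (l1 l2 m1 m2 : ℝ) (N : ℕ) (y : ℝ) : ℝ :=
  (l1 * (alphaf l1 l2 m1 y - 1) + l2 * (y - 1)) * L3f l1 l2 m1 m2 N y /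
    (Afun l1 l2 m2 y - l1 * y * alphaf l1 l2 m1 y)

/-- L1(x,y) = λ1μ2(x−α(y))(y−1)·L3(y)/(x·K(x,y)·(A(y)−λ1·y·α(y))). -/
def L1f (l1 l2 m1 m2 : ℝ) (N : ℕ) (x y : ℝ) : ℝ :=
  l1 * m2 * (x - alphaf l1 l2 m1 y) * (y - 1) * L3f l1 l2 m1 m2 N y /
    (x * Kker l1 l2 m1 x y * (Afun l1 l2 m2 y - l1 * y * alphaf l1 l2 m1 y))

/-- Λ(y) = α(y)·(y·L2(y)+L3(y))/(x2(y)−x1(y)). -/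
def Lamf (l1 l2 m1 m2 : ℝ) (N : ℕ) (y : ℝ) : ℝ :=
  alphaf l1 l2 m1 y * (y * L2f l1 l2 m1 m2 N y + L3f l1 l2 m1 m2 N y) /
    (x2f l1 l2 m1 y - alphaf l1 l2 m1 y)

/-- b1 = λ2/(λ2+(√μ1−√λ1)²). -/
def b1v (l1 l2 m1 : ℝ) : ℝ := l2 / (l2 + (Real.sqrt m1 - Real.sqrt l1) ^ 2)

/-- b2 = λ2/(λ2+(√μ1+√λ1)²). -/
def b2v (l1 l2 m1 : ℝ) : ℝ := l2 / (l2 + (Real.sqrt m1 + Real.sqrt l1) ^ 2)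

/-- F(y) = λ2·y² − (1−2μ1+μ2)·y + 2μ2. -/
def Ff (l2 m1 m2 y : ℝ) : ℝ := l2 * y ^ 2 - (1 - 2 * m1 + m2) * y + 2 * m2

/-- T*(y) = F(y) + y·√Δ(y). -/
def Tstar (l1 l2 m1 m2 y : ℝ) : ℝ :=
  Ff l2 m1 m2 y + y * Real.sqrt (Delta l1 l2 m1 y)

/-- T(y) = F(y) − y·√Δ(y). -/
def Tm (l1 l2 m1 m2 y : ℝ) : ℝ :=
  Ff l2 m1 m2 y - y * Real.sqrt (Delta l1 l2 m1 y)

/-- η1 = ((1−2μ1) + √((1−2μ1)²+4(μ1−μ2)λ2))/(2μ2). -/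
def eta1 (l2 m1 m2 : ℝ) : ℝ :=
  (1 - 2 * m1 + Real.sqrt ((1 - 2 * m1) ^ 2 + 4 * (m1 - m2) * l2)) / (2 * m2)

/-- η2 = ((1−2μ1) − √((1−2μ1)²+4(μ1−μ2)λ2))/(2μ2). -/
def eta2 (l2 m1 m2 : ℝ) : ℝ :=
  (1 - 2 * m1 - Real.sqrt ((1 - 2 * m1) ^ 2 + 4 * (m1 - m2) * l2)) / (2 * m2)

/-- a = ((1−ρ1−ρ2)/(2μ2))·η1/(η1−η2). -/
def av (l1 l2 m1 m2 : ℝ) : ℝ :=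
  (1 - l1 / m1 - l2 / m2) / (2 * m2) * (eta1 l2 m1 m2 / (eta1 l2 m1 m2 - eta2 l2 m1 m2))

/-- b = ((1−ρ1−ρ2)/(2μ2))·η2/(η2−η1). -/
def bv (l1 l2 m1 m2 : ℝ) : ℝ :=
  (1 - l1 / m1 - l2 / m2) / (2 * m2) * (eta2 l2 m1 m2 / (eta2 l2 m1 m2 - eta1 l2 m1 m2))

/-- ι(y) = (μ1−λ+λ2y−√Δ(y))/(2μ2(y−1)). -/
def iotaf (l1 l2 m1 m2 y : ℝ) : ℝ :=
  (m1 - (l1 + l2) + l2 * y - Real.sqrt (Delta l1 l2 m1 y)) / (2 * m2 * (y - 1))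

/-- κ(y) = (2μ2(1−y) − (1−μ1y)·T(y))/(2μ1μ2·y(1−y)(1−ρ̄1·y)). -/
def kappaf (l1 l2 m1 m2 y : ℝ) : ℝ :=
  (2 * m2 * (1 - y) - (1 - m1 * y) * Tm l1 l2 m1 m2 y) /
    (2 * m1 * m2 * y * (1 - y) * (1 - (l1 + l2) / m1 * y))

/-- c0 = ((λ+μ1) − √((λ+μ1)² − 4λ1μ1))/(2μ1). -/
def c0v (l1 l2 m1 : ℝ) : ℝ :=
  (l1 + l2 + m1 - Real.sqrt ((l1 + l2 + m1) ^ 2 - 4 * l1 * m1)) / (2 * m1)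

/-- c1 = λ2·c0/√((λ+μ1)² − 4λ1μ1). -/
def c1v (l1 l2 m1 : ℝ) : ℝ :=
  l2 * c0v l1 l2 m1 / Real.sqrt ((l1 + l2 + m1) ^ 2 - 4 * l1 * m1)

/-- D = (λ+μ1−2√(λ1μ1))(μ1−μ2−√(λ1μ1)) + λ2μ2. -/
def Dv (l1 l2 m1 m2 : ℝ) : ℝ :=
  (l1 + l2 + m1 - 2 * Real.sqrt (l1 * m1)) * (m1 - m2 - Real.sqrt (l1 * m1)) + l2 * m2

/-- K(η) = λ2·b1·√(1 − b2/b1)/(2·√(b1·b2)·(η − b1)). -/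
def Kcv (l1 l2 m1 η : ℝ) : ℝ :=
  l2 * b1v l1 l2 m1 * Real.sqrt (1 - b2v l1 l2 m1 / b1v l1 l2 m1) /
    (2 * Real.sqrt (b1v l1 l2 m1 * b2v l1 l2 m1) * (η - b1v l1 l2 m1))

/-- σ(η) = K(η)/(b1·√π). -/
def sigmav (l1 l2 m1 η : ℝ) : ℝ :=
  Kcv l1 l2 m1 η / (b1v l1 l2 m1 * Real.sqrt Real.pi)

/-- K1(η). -/
def K1v (l1 l2 m1 m2 η : ℝ) : ℝ :=
  l2 * b1v l1 l2 m1 * Real.sqrt (1 - b2v l1 l2 m1 / b1v l1 l2 m1) *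
      ((1 - m1 / b1v l1 l2 m1) * (Ff l2 m1 m2 (1 / b1v l1 l2 m1) + 1)
        - 2 * m2 * (1 - 1 / b1v l1 l2 m1)) /
    (4 * m1 * m2 * Real.sqrt (b1v l1 l2 m1 * b2v l1 l2 m1) * (1 - η / b1v l1 l2 m1) *
      (1 - 1 / b1v l1 l2 m1) * (1 - (l1 + l2) / m1 / b1v l1 l2 m1))

/-- σ1(η) = K1(η)/(b1·√π). -/
def sigma1v (l1 l2 m1 m2 η : ℝ) : ℝ :=
  K1v l1 l2 m1 m2 η / (b1v l1 l2 m1 * Real.sqrt Real.pi)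

/-- Kernel roots: for `λ1, λ2, μ1 > 0` and `y ∈ [0,1)`, `Δ(y) > 0`,
`0 < x1(y) < 1 < x2(y)`, the factorization `x·K(x,y) = −λ1(x−x1(y))(x−x2(y))`
holds for every `x ≠ 0`, and `α(y) = x1(y)` is the unique zero of
`x ↦ x·K(x,y)` in `[0,1]`. -/
theorem stmt1 (l1 l2 m1 : ℝ) (hl1 : 0 < l1) (hl2 : 0 < l2) (hm1 : 0 < m1)
    (y : ℝ) (hy : y ∈ Ico (0:ℝ) 1) :
    0 < Delta l1 l2 m1 y ∧
    0 < alphaf l1 l2 m1 y ∧ alphaf l1 l2 m1 y < 1 ∧ 1 < x2f l1 l2 m1 y ∧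
    (∀ x : ℝ, x ≠ 0 →
      x * Kker l1 l2 m1 x y
        = -l1 * (x - alphaf l1 l2 m1 y) * (x - x2f l1 l2 m1 y)) ∧
    (∀ x ∈ Icc (0:ℝ) 1, x ≠ 0 →
      (x * Kker l1 l2 m1 x y = 0 ↔ x = alphaf l1 l2 m1 y)) := by
  obtain ⟨-, hy1⟩ := hy
  have hd : 0 < l2 * (1 - y) := mul_pos hl2 (sub_pos.2 hy1)
  have hdl : 0 < l2 * (1 - y) * l1 := mul_pos hd hl1
  have hdm : 0 < l2 * (1 - y) * m1 := mul_pos hd hm1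
  have hlm : 0 < l1 * m1 := mul_pos hl1 hm1
  have hΔ : 0 < Delta l1 l2 m1 y := by
    unfold Delta
    nlinarith [sq_nonneg (l1 - m1), sq_nonneg (l2 * (1 - y))]
  have hlt : √(Delta l1 l2 m1 y) < l1 + l2 + m1 - l2 * y := by
    rw [Real.sqrt_lt' (by linarith)]
    unfold Delta
    linarith
  have habs : |l2 + m1 - l2 * y - l1| < √(Delta l1 l2 m1 y) := by
    rw [Real.lt_sqrt (abs_nonneg _), sq_abs]
    unfold Delta
    linarith
  obtain ⟨hneg, hpos⟩ := abs_lt.1 habs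
  have hα0 : 0 < alphaf l1 l2 m1 y := div_pos (sub_pos.2 hlt) (by linarith)
  have hα1 : alphaf l1 l2 m1 y < 1 := by
    unfold alphaf
    rw [div_lt_one (by linarith)]
    linarith
  have hx2 : 1 < x2f l1 l2 m1 y := by
    unfold x2f
    rw [one_lt_div (by linarith)]
    linarith
  have hfac : ∀ x : ℝ, x ≠ 0 → x * Kker l1 l2 m1 x y
      = -l1 * (x - alphaf l1 l2 m1 y) * (x - x2f l1 l2 m1 y) := by
    intro x hx
    have hsq : √(Delta l1 l2 m1 y) ^ 2 = (l1 + l2 + m1 - l2 * y) ^ 2 - 4 * l1 * m1 :=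
      Real.sq_sqrt hΔ.le
    unfold Kker alphaf x2f
    field_simp
    linear_combination -hsq
  refine ⟨hΔ, hα0, hα1, hx2, hfac, fun x hx hx0 => ?_⟩
  have hne : x - x2f l1 l2 m1 y ≠ 0 := (by linarith [hx.2] : x - x2f l1 l2 m1 y < 0).ne
  rw [hfac x hx0, mul_eq_zero_iff_right hne, mul_eq_zero_iff_left (neg_ne_zero.2 hl1.ne'),
    sub_eq_zero]

end
end

section
/- Let λ1, λ2, μ1, μ2 > 0 and fix y ∈ (0,1), and suppose A(y) − λ1·y·α(y) ≠ 0. Let f : (0,1] → ℝ and let g, ℓ2, ℓ3 be real numbers such that: (i) x·K(x,y)·f(x) = λ1·x·(y·ℓ2 + ℓ3) − μ1·g for every x ∈ (0,1]; and (ii) A(y)·ℓ2 = μ1·g − (λ1 + λ2(1−y))·ℓ3. Then: μ1·g = λ1·α(y)·(y·ℓ2 + ℓ3); ℓ2 = [λ1(α(y)−1) + λ2(y−1)]·ℓ3 / (A(y) − λ1·y·α(y)); and for every x ∈ (0,1] with x·K(x,y) ≠ 0, f(x) = λ1·μ2·(x − α(y))·(y−1)·ℓ3 / (x·K(x,y)·(A(y)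 − λ1·y·α(y))). -/
open Real Filter Topology Set

noncomputable section

theorem Delta_pos {l1 l2 m1 y : ℝ} (hl1 : 0 < l1) (hl2 : 0 < l2) (hm1 : 0 < m1) (hy : y < 1) :
    0 < Delta l1 l2 m1 y := by
  have he : 0 < l2 * (1 - y) := mul_pos hl2 (sub_pos.2 hy)
  have h : Delta l1 l2 m1 y = (l1 - m1) ^ 2 + l2 * (1 - y) * (2 * (l1 + m1) + l2 * (1 - y)) := by
    unfold Delta; ring
  rw [h]
  positivity

theorem alphaf_mem_Ioo {l1 l2 m1 y : ℝ} (hl1 : 0 < l1) (hl2 : 0 < l2) (hm1 : 0 < m1)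
    (hy : y < 1) : alphaf l1 l2 m1 y ∈ Ioo (0 : ℝ) 1 := by
  have he : 0 < l2 * (1 - y) := mul_pos hl2 (sub_pos.2 hy)
  have hlt : √(Delta l1 l2 m1 y) < l1 + l2 + m1 - l2 * y := by
    rw [Real.sqrt_lt' (by linarith)]
    unfold Delta
    linarith [mul_pos hl1 hm1]
  have hgt : l2 + m1 - l2 * y - l1 < √(Delta l1 l2 m1 y) := by
    apply Real.lt_sqrt_of_sq_lt
    unfold Delta
    linarith [mul_pos hl1 he]
  unfold alphaf
  constructor
  · apply div_pos <;> linarith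
  · rw [div_lt_one (by linarith)]
    linarith

/-- The point `α(y)` is a zero of the kernel polynomial `x·K(x,y)`. -/
theorem alphaf_mul_Kker {l1 l2 m1 y : ℝ} (hl1 : 0 < l1) (hl2 : 0 < l2) (hm1 : 0 < m1)
    (hy : y < 1) : alphaf l1 l2 m1 y * Kker l1 l2 m1 (alphaf l1 l2 m1 y) y = 0 := by
  have ha : alphaf l1 l2 m1 y ≠ 0 := (alphaf_mem_Ioo hl1 hl2 hm1 hy).1.ne'
  have hs : √(Delta l1 l2 m1 y) = l1 + l2 + m1 - l2 * y - 2 * l1 * alphaf l1 l2 m1 y := by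
    unfold alphaf
    field_simp
    ring
  have hq := Real.sq_sqrt (Delta_pos hl1 hl2 hm1 hy).le
  rw [hs, Delta] at hq
  have hK : alphaf l1 l2 m1 y * Kker l1 l2 m1 (alphaf l1 l2 m1 y) y =
      (l1 + l2 + m1 - l2 * y) * alphaf l1 l2 m1 y - l1 * alphaf l1 l2 m1 y ^ 2 - m1 := by
    unfold Kker
    field_simp
    ring
  rw [hK]
  apply mul_left_cancel₀ (mul_pos four_pos hl1).ne'
  linear_combination -hq

/-- The kernel method: if `f`, `g`, `ℓ2`, `ℓ3` satisfy the functional equation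
`x·K(x,y)·f(x) = λ1·x·(y·ℓ2 + ℓ3) − μ1·g` on `(0,1]` and
`A(y)·ℓ2 = μ1·g − (λ1+λ2(1−y))·ℓ3`, then `g`, `ℓ2` and `f` are determined. -/
theorem stmt3 (l1 l2 m1 m2 : ℝ) (hl1 : 0 < l1) (hl2 : 0 < l2) (hm1 : 0 < m1) (hm2 : 0 < m2)
    (y : ℝ) (hy : y ∈ Ioo (0:ℝ) 1)
    (hden : Afun l1 l2 m2 y - l1 * y * alphaf l1 l2 m1 y ≠ 0)
    (f : ℝ → ℝ) (g t2 t3 : ℝ)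
    (hf : ∀ x ∈ Ioc (0:ℝ) 1,
      x * Kker l1 l2 m1 x y * f x = l1 * x * (y * t2 + t3) - m1 * g)
    (h2 : Afun l1 l2 m2 y * t2 = m1 * g - (l1 + l2 * (1 - y)) * t3) :
    m1 * g = l1 * alphaf l1 l2 m1 y * (y * t2 + t3) ∧
    t2 = (l1 * (alphaf l1 l2 m1 y - 1) + l2 * (y - 1)) * t3 /
        (Afun l1 l2 m2 y - l1 * y * alphaf l1 l2 m1 y) ∧
    ∀ x ∈ Ioc (0:ℝ) 1, x * Kker l1 l2 m1 x y ≠ 0 →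
      f x = l1 * m2 * (x - alphaf l1 l2 m1 y) * (y - 1) * t3 /
        (x * Kker l1 l2 m1 x y * (Afun l1 l2 m2 y - l1 * y * alphaf l1 l2 m1 y)) := by
  have hα := alphaf_mem_Ioo hl1 hl2 hm1 hy.2
  have hg : m1 * g = l1 * alphaf l1 l2 m1 y * (y * t2 + t3) := by
    have h := hf _ ⟨hα.1, hα.2.le⟩
    rw [alphaf_mul_Kker hl1 hl2 hm1 hy.2] at h
    linarith
  have ht : t2 * (Afun l1 l2 m2 y - l1 * y * alphaf l1 l2 m1 y) =
      (l1 * (alphaf l1 l2 m1 y - 1) + l2 * (y - 1)) * t3 := by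
    linear_combination h2 + hg
  refine ⟨hg, (eq_div_iff hden).2 ht, fun x hx hK => ?_⟩
  have hsum : (y * t2 + t3) * (Afun l1 l2 m2 y - l1 * y * alphaf l1 l2 m1 y) =
      m2 * (y - 1) * t3 := by
    unfold Afun at ht ⊢
    linear_combination y * ht
  rw [eq_div_iff (mul_ne_zero hK hden)]
  linear_combination (Afun l1 l2 m2 y - l1 * y * alphaf l1 l2 m1 y) * (hf x hx - hg) +
    l1 * (x - alphaf l1 l2 m1 y) * hsum

end
end

section
/- Let λ1, λ2, μ1, μ2 > 0 with ρ1 = λ1/μ1 < 1 and ρ1 + ρ2 < 1 where ρ2 = λ2/μ2, and let N ≥ 1 be an integer. Then lim_{y→1⁻} L2(y) = ρ2, where L2(y) = [λ1(α(y)−1) + λ2(y−1)]·β(y)·(1−ρ1−ρ2) / (A(y) − λ1·y·α(y)). -/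
open Real Filter Topology Set

noncomputable section

/-- The l’Hôpital rule at a common zero, from derivatives at the point only. -/
theorem tendsto_div_of_hasDerivAt_of_eq_zero {f g : ℝ → ℝ} {f' g' a : ℝ}
    (hf : HasDerivAt f f' a) (hg : HasDerivAt g g' a) (hfa : f a = 0) (hga : g a = 0)
    (hg' : g' ≠ 0) : Tendsto (fun y => f y / g y) (𝓝[≠] a) (𝓝 (f' / g')) := by
  refine (hf.tendsto_slope.div hg.tendsto_slope hg').congr' ?_
  filter_upwards [self_mem_nhdsWithin] with y hy
  have hya : y - a ≠ 0 := sub_ne_zero.mpr hy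
  simp only [Pi.div_apply, slope_def_field, hfa, hga, sub_zero]
  exact div_div_div_cancel_right₀ hya _ _

theorem sqrt_Delta_one {l1 m1 : ℝ} (l2 : ℝ) (h : l1 < m1) :
    √(Delta l1 l2 m1 1) = m1 - l1 := by
  rw [show Delta l1 l2 m1 1 = (m1 - l1) ^ 2 by unfold Delta; ring]
  exact Real.sqrt_sq (sub_pos.mpr h).le

theorem alphaf_one {l1 m1 : ℝ} (l2 : ℝ) (hl1 : l1 ≠ 0) (h : l1 < m1) :
    alphaf l1 l2 m1 1 = 1 := by
  rw [alphaf, sqrt_Delta_one l2 h]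
  field_simp
  ring

theorem hasDerivAt_alphaf_one {l1 m1 : ℝ} (l2 : ℝ) (hl1 : l1 ≠ 0) (h : l1 < m1) :
    HasDerivAt (alphaf l1 l2 m1) (l2 / (m1 - l1)) 1 := by
  have hne : m1 - l1 ≠ 0 := (sub_pos.mpr h).ne'
  have hlin : HasDerivAt (fun y => l1 + l2 + m1 - l2 * y) (-(l2 * 1)) 1 :=
    ((hasDerivAt_id (1 : ℝ)).const_mul l2).const_sub _
  have hDelta : HasDerivAt (Delta l1 l2 m1) (-2 * l2 * (l1 + m1)) 1 := by
    refine ((hlin.pow 2).sub_const (4 * l1 * m1)).congr_deriv ?_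
    push_cast
    ring
  have hDelta_ne : Delta l1 l2 m1 1 ≠ 0 := by
    rw [show Delta l1 l2 m1 1 = (m1 - l1) ^ 2 by unfold Delta; ring]
    exact pow_ne_zero 2 hne
  refine ((hlin.sub (hDelta.sqrt hDelta_ne)).div_const (2 * l1)).congr_deriv ?_
  rw [sqrt_Delta_one l2 h]
  field_simp
  ring

theorem tendsto_betaf_one {l1 l2 : ℝ} (hl1 : 0 < l1) (hl2 : 0 < l2) {N : ℕ} (hN : 1 ≤ N) :
    Tendsto (betaf l1 l2 N) (𝓝 1) (𝓝 1) := by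
  have hpos : 0 < ∑ k ∈ Finset.range N, (l2 / (l1 + l2) * 1) ^ k :=
    Finset.sum_pos (fun k _ => by positivity) ⟨0, Finset.mem_range.mpr hN⟩
  have hcont : Continuous (betaf l1 l2 N) := by
    unfold betaf
    fun_prop
  have hone : betaf l1 l2 N 1 = 1 := div_self hpos.ne'
  simpa only [hone] using hcont.tendsto 1

/-- `lim_{y→1⁻} L2(y) = ρ2`. -/
theorem stmt4 (l1 l2 m1 m2 : ℝ) (hl1 : 0 < l1) (hl2 : 0 < l2) (hm1 : 0 < m1) (hm2 : 0 < m2)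
    (hr1 : l1 / m1 < 1) (hr : l1 / m1 + l2 / m2 < 1) (N : ℕ) (hN : 1 ≤ N) :
    Tendsto (fun y => L2f l1 l2 m1 m2 N y) (𝓝[<] (1:ℝ)) (𝓝 (l2 / m2)) := by
  have hlt : l1 < m1 := (div_lt_one hm1).mp hr1
  have hne : m1 - l1 ≠ 0 := (sub_pos.mpr hlt).ne'
  have hrho : 1 - l1 / m1 - l2 / m2 ≠ 0 := by linarith
  have hα := hasDerivAt_alphaf_one l2 hl1.ne' hlt
  have hα1 := alphaf_one l2 hl1.ne' hlt
  have hid := hasDerivAt_id' (1 : ℝ)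
  have hnum : HasDerivAt (fun y => l1 * (alphaf l1 l2 m1 y - 1) + l2 * (y - 1))
      (l2 * m1 / (m1 - l1)) 1 := by
    refine (((hα.sub_const 1).const_mul l1).add
      ((hid.sub_const 1).const_mul l2)).congr_deriv ?_
    field_simp
    ring
  have hden : HasDerivAt (fun y => Afun l1 l2 m2 y - l1 * y * alphaf l1 l2 m1 y)
      (m1 * m2 * (1 - l1 / m1 - l2 / m2) / (m1 - l1)) 1 := by
    refine ((((hid.const_mul l1).add ((hid.const_mul l2).mul (hid.const_sub 1))).add
      ((hid.sub_const 1).const_mul m2)).sub ((hid.const_mul l1).mul hα)).congr_deriv ?_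
    rw [hα1]
    field_simp
    ring
  have hratio := tendsto_div_of_hasDerivAt_of_eq_zero hnum hden (by simp [hα1])
    (by simp [hα1, Afun])
    (div_ne_zero (mul_ne_zero (mul_ne_zero hm1.ne' hm2.ne') hrho) hne)
  have hL3 : Tendsto (L3f l1 l2 m1 m2 N) (𝓝 1) (𝓝 (1 * (1 - l1 / m1 - l2 / m2))) :=
    (tendsto_betaf_one hl1 hl2 hN).mul_const _
  have hlim := (hratio.mono_left (nhdsWithin_mono 1 fun y (hy : y < 1) => hy.ne)).mul
    (hL3.mono_left nhdsWithin_le_nhds)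
  have hval : l2 * m1 / (m1 - l1) / (m1 * m2 * (1 - l1 / m1 - l2 / m2) / (m1 - l1)) *
      (1 * (1 - l1 / m1 - l2 / m2)) = l2 / m2 := by
    generalize 1 - l1 / m1 - l2 / m2 = c at hrho
    field_simp
  rw [hval] at hlim
  exact hlim.congr fun y => div_mul_eq_mul_div _ _ _

end
end

section
/- Let λ1, λ2, μ1, μ2 > 0 with ρ1 + ρ2 < 1 where ρ1 = λ1/μ1, ρ2 = λ2/μ2, set ρ̄1 = (λ1+λ2)/μ1, and let N ≥ 1 be an integer. Let y ∈ (0,1) with A(y) − λ1·y·α(y) ≠ 0. Then: (i) L1(1,y) = ((μ2 − λ2·y)/λ2)·L2(y) − L3(y); (ii) if moreover y·K(y,y) ≠ 0 and 1 − ρ̄1·y ≠ 0, then L1(y,y) = [ (λ·y − μ2)·L2(y) + λ·L3(y) ] / ( μ1·(1 − ρ̄1·y) ), where λ = λ1+λ2; (iii) for every x ∈ (0,1) with x ≠ c0/ρ1, L1(x,0) = c0·L3(0)/(1 − c0·x), where c0 = ((λ+μ1) − √((λ+μ1)² − 4λ1μ1))/(2μ1). -/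
open Real Filter Topology Set

noncomputable section

theorem c0v_quadratic {l1 l2 m1 : ℝ} (hl1 : 0 < l1) (hl2 : 0 < l2) (hm1 : 0 < m1) :
    m1 * c0v l1 l2 m1 ^ 2 + l1 = (l1 + l2 + m1) * c0v l1 l2 m1 := by
  have hdisc : 0 ≤ (l1 + l2 + m1) ^ 2 - 4 * l1 * m1 := by
    nlinarith [sq_nonneg (l1 - m1), mul_pos hl2 hl1, mul_pos hl2 hm1, sq_nonneg l2]
  have hsq := Real.sq_sqrt hdisc
  unfold c0v
  generalize √((l1 + l2 + m1) ^ 2 - 4 * l1 * m1) = s at hsq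
  field_simp
  linear_combination hsq

theorem alphaf_zero {l1 l2 m1 : ℝ} (hl1 : 0 < l1) (hm1 : 0 < m1) :
    l1 * alphaf l1 l2 m1 0 = m1 * c0v l1 l2 m1 := by
  unfold alphaf c0v Delta
  rw [mul_zero, sub_zero]
  field_simp

/-- Equations (44), (45) and (451) of Proposition 5. -/
theorem stmt8 (l1 l2 m1 m2 : ℝ) (hl1 : 0 < l1) (hl2 : 0 < l2) (hm1 : 0 < m1) (hm2 : 0 < m2)
    (hr : l1 / m1 + l2 / m2 < 1) (N : ℕ) (hN : 1 ≤ N)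
    (y : ℝ) (hy : y ∈ Ioo (0:ℝ) 1)
    (hden : Afun l1 l2 m2 y - l1 * y * alphaf l1 l2 m1 y ≠ 0) :
    L1f l1 l2 m1 m2 N 1 y
        = (m2 - l2 * y) / l2 * L2f l1 l2 m1 m2 N y - L3f l1 l2 m1 m2 N y ∧
    (y * Kker l1 l2 m1 y y ≠ 0 → 1 - (l1 + l2) / m1 * y ≠ 0 →
      L1f l1 l2 m1 m2 N y y
        = (((l1 + l2) * y - m2) * L2f l1 l2 m1 m2 N y + (l1 + l2) * L3f l1 l2 m1 m2 N y)
            / (m1 * (1 - (l1 + l2) / m1 * y))) ∧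
    (∀ x ∈ Ioo (0:ℝ) 1, x ≠ c0v l1 l2 m1 / (l1 / m1) →
      L1f l1 l2 m1 m2 N x 0
        = c0v l1 l2 m1 * L3f l1 l2 m1 m2 N 0 / (1 - c0v l1 l2 m1 * x)) := by
  obtain ⟨hy0, hy1⟩ := hy
  have hy1' : 1 - y ≠ 0 := by linarith
  refine ⟨?_, ?_, ?_⟩
  · have hK : Kker l1 l2 m1 1 y = l2 * (1 - y) := by simp [Kker]
    unfold L1f L2f
    rw [hK]
    generalize hD : Afun l1 l2 m2 y - l1 * y * alphaf l1 l2 m1 y = D at hden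
    unfold Afun at hD
    field_simp
    rw [← hD]
    ring
  · intro _ hρ
    have hK : y * Kker l1 l2 m1 y y = -(1 - y) * (m1 * (1 - (l1 + l2) / m1 * y)) := by
      unfold Kker
      field_simp
      ring
    have hE : m1 * (1 - (l1 + l2) / m1 * y) ≠ 0 := mul_ne_zero hm1.ne' hρ
    unfold L1f L2f
    rw [hK]
    generalize m1 * (1 - (l1 + l2) / m1 * y) = E at hE
    generalize hD : Afun l1 l2 m2 y - l1 * y * alphaf l1 l2 m1 y = D at hden
    unfold Afun at hD
    field_simp
    rw [← hD]
    ring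
  · rintro x ⟨hx0, _⟩ hx
    have hq := c0v_quadratic hl1 hl2 hm1
    have hα := alphaf_zero (l2 := l2) hl1 hm1
    have hD : Afun l1 l2 m2 0 - l1 * 0 * alphaf l1 l2 m1 0 = -m2 := by simp [Afun]
    unfold L1f
    rw [hD]
    generalize alphaf l1 l2 m1 0 = a at hα
    generalize c0v l1 l2 m1 = c at *
    have hc : c ≠ 0 := by
      rintro rfl
      nlinarith
    have hne : l1 * x - m1 * c ≠ 0 := by
      intro h
      apply hx
      field_simp
      linarith
    have hfac : c * (x * Kker l1 l2 m1 x 0) = (1 - c * x) * (l1 * x - m1 * c) := by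
      unfold Kker
      field_simp
      linear_combination -x * hq
    have hK : x * Kker l1 l2 m1 x 0 = (1 - c * x) * (l1 * x - m1 * c) / c := by
      rw [← hfac]
      field_simp
    have hnum : l1 * m2 * (x - a) * (0 - 1) * L3f l1 l2 m1 m2 N 0
        = -m2 * (l1 * x - m1 * c) * L3f l1 l2 m1 m2 N 0 := by
      rw [← hα]
      ring
    rw [hK, hnum]
    field_simp

end
end

section
/- Let λ1, λ2, μ1 > 0 and set λ = λ1+λ2, ρ1 = λ1/μ1, c0 = ((λ+μ1) − √((λ+μ1)² − 4λ1μ1))/(2μ1), x1 = c0/ρ1 and x2 = 1/c0, so that x1 and x2 are the two roots of λ1·x² − (λ+μ1)·x + μ1 = 0 with 0 < x1 < 1 < x2. Let ψ, ψ' : [0,1) → ℝ and let d be a real number such that for every x ∈ [0,1): −λ1·(x−x1)·(x−x2)·ψ'(x) = λ2·x·ψ(x) + λ1·x·d − μ1·ψ'(0). Then: μ1·ψ'(0) = λ2·x1·ψ(x1) + λ1·x1·d, and for every x ∈ [0,1) with x ≠ x1: ψ'(x) = a*/(1−c0·x) + (λ2·c0·x/(λ1·(1−c0·x)))·(ψ(x)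 − ψ(x1))/(x − x1), where a* = (c0/λ1)·(λ2·ψ(x1) + λ1·d). -/
open Real Filter Topology Set

noncomputable section

/-- `c0` is the root in `(0, min 1 (λ1/μ1))` of `μ1·c² − (λ+μ1)·c + λ1`. -/
theorem c0v_spec {l1 l2 m1 : ℝ} (hl1 : 0 < l1) (hl2 : 0 < l2) (hm1 : 0 < m1) :
    m1 * c0v l1 l2 m1 ^ 2 - (l1 + l2 + m1) * c0v l1 l2 m1 + l1 = 0 ∧
      0 < c0v l1 l2 m1 ∧ c0v l1 l2 m1 < 1 ∧ m1 * c0v l1 l2 m1 < l1 := by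
  have h1 : l1 + l2 - m1 < √((l1 + l2 + m1) ^ 2 - 4 * l1 * m1) :=
    Real.lt_sqrt_of_sq_lt (by nlinarith [mul_pos hl2 hm1])
  have h2 : l2 + m1 - l1 < √((l1 + l2 + m1) ^ 2 - 4 * l1 * m1) :=
    Real.lt_sqrt_of_sq_lt (by nlinarith [mul_pos hl1 hl2])
  have h3 : √((l1 + l2 + m1) ^ 2 - 4 * l1 * m1) < l1 + l2 + m1 :=
    (Real.sqrt_lt' (by positivity)).2 (by nlinarith [mul_pos hl1 hm1])
  have hsq : √((l1 + l2 + m1) ^ 2 - 4 * l1 * m1) ^ 2 = (l1 + l2 + m1) ^ 2 - 4 * l1 * m1 :=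
    Real.sq_sqrt (by nlinarith [mul_pos hl1 hl2, mul_pos hl2 hm1, sq_nonneg (l1 - m1)])
  have hc : √((l1 + l2 + m1) ^ 2 - 4 * l1 * m1) = l1 + l2 + m1 - 2 * m1 * c0v l1 l2 m1 := by
    rw [c0v]; field_simp; ring
  rw [hc] at h1 h2 h3 hsq
  refine ⟨?_, ?_, ?_, by linarith⟩
  · refine (mul_eq_zero.1 (?_ : 4 * m1 * _ = 0)).resolve_left (by positivity)
    linear_combination hsq
  · exact pos_of_mul_pos_right (by linarith : 0 < 2 * m1 * c0v l1 l2 m1) (by positivity)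
  · exact lt_of_mul_lt_mul_left (by linarith : 2 * m1 * c0v l1 l2 m1 < 2 * m1 * 1)
      (by positivity)

/-- Proposition 6: `x1`, `x2` are the kernel roots with `0 < x1 < 1 < x2`, the
analyticity condition `μ1·ψ'(0) = λ2·x1·ψ(x1) + λ1·x1·d` holds, and the
recursion (453) follows. -/
theorem stmt9 (l1 l2 m1 : ℝ) (hl1 : 0 < l1) (hl2 : 0 < l2) (hm1 : 0 < m1)
    (x1 x2 : ℝ) (hx1 : x1 = c0v l1 l2 m1 / (l1 / m1)) (hx2 : x2 = 1 / c0v l1 l2 m1)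
    (psi psiJ : ℝ → ℝ) (d : ℝ)
    (hbal : ∀ x ∈ Ico (0:ℝ) 1,
      -l1 * (x - x1) * (x - x2) * psiJ x = l2 * x * psi x + l1 * x * d - m1 * psiJ 0) :
    (l1 * x1 ^ 2 - (l1 + l2 + m1) * x1 + m1 = 0) ∧
    (l1 * x2 ^ 2 - (l1 + l2 + m1) * x2 + m1 = 0) ∧
    0 < x1 ∧ x1 < 1 ∧ 1 < x2 ∧
    m1 * psiJ 0 = l2 * x1 * psi x1 + l1 * x1 * d ∧
    ∀ x ∈ Ico (0:ℝ) 1, x ≠ x1 →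
      psiJ x = (c0v l1 l2 m1 / l1) * (l2 * psi x1 + l1 * d) / (1 - c0v l1 l2 m1 * x)
        + l2 * c0v l1 l2 m1 * x / (l1 * (1 - c0v l1 l2 m1 * x))
          * ((psi x - psi x1) / (x - x1)) := by
  obtain ⟨hc, hc0, hc1, hcl⟩ := c0v_spec hl1 hl2 hm1
  generalize c0v l1 l2 m1 = c at *
  have hx1c : l1 * x1 = m1 * c := by rw [hx1]; field_simp
  have hx2c : c * x2 = 1 := by rw [hx2]; field_simp
  have hx1pos : 0 < x1 := by rw [hx1]; positivity
  have hx1lt : x1 < 1 := lt_of_mul_lt_mul_left (by linarith : l1 * x1 < l1 * 1) hl1.le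
  have hx2lt : 1 < x2 := by rw [hx2]; exact (one_lt_div hc0).2 hc1
  have hana : m1 * psiJ 0 = l2 * x1 * psi x1 + l1 * x1 * d := by
    linear_combination hbal x1 ⟨hx1pos.le, hx1lt⟩
  refine ⟨?_, ?_, hx1pos, hx1lt, hx2lt, hana, fun x hx hne => ?_⟩
  · refine (mul_eq_zero.1 (?_ : l1 * _ = 0)).resolve_left hl1.ne'
    linear_combination (l1 * x1 + m1 * c - (l1 + l2 + m1)) * hx1c + m1 * hc
  · rw [hx2]; field_simp; linear_combination hc
  · have hden : 1 - c * x ≠ 0 := by nlinarith [hx.1, hx.2]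
    have hsub : x - x1 ≠ 0 := sub_ne_zero.2 hne
    field_simp
    linear_combination c * hbal x hx - c * hana - l1 * (x - x1) * psiJ x * hx2c

end
end

section
/- Let λ1, λ2, μ1 > 0 and set λ = λ1+λ2, ρ1 = λ1/μ1, c0 = ((λ+μ1) − √((λ+μ1)² − 4λ1μ1))/(2μ1), c1 = λ2·c0/√((λ+μ1)² − 4λ1μ1), x1 = c0/ρ1, so that 0 < x1 < 1 < 1/c0. Let L₀ be a real number and suppose ψ_j : [0, 1/c0) → ℝ (for j ∈ ℕ) satisfy: ψ_0(x) = c0·L₀/(1 − c0·x) for all x ∈ [0,1/c0); and for each j ≥ 1 there is a real number a_j such that for all x ∈ [0,1/c0) with x ≠ x1: ψ_j(x) = a_j/(1−c0·x) + (λ2·c0·x/(λ1·(1−c0·x)))·(ψ_{j−1}(x) − ψ_{j−1}(x1))/(x − x1). Then for every j ∈ ℕ: lim_{x→(1/c0)⁻} (1−c0·x)^{j+1}·ψ_j(x) = c0·L₀·(c1/c0)^j. -/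
open Real Filter Topology Set

noncomputable section

/-- The discriminant at `y = 0` is positive. -/
theorem discriminant_pos {l1 l2 m1 : ℝ} (hl1 : 0 < l1) (hl2 : 0 < l2) (hm1 : 0 < m1) :
    0 < (l1 + l2 + m1) ^ 2 - 4 * l1 * m1 := by
  nlinarith [sq_nonneg (l1 - m1), mul_pos hl1 hl2, mul_pos hl2 hm1, mul_pos hl2 hl2]

theorem c0v_pos {l1 l2 m1 : ℝ} (hl1 : 0 < l1) (hl2 : 0 < l2) (hm1 : 0 < m1) :
    0 < c0v l1 l2 m1 := by
  have hsqrt : √((l1 + l2 + m1) ^ 2 - 4 * l1 * m1) < l1 + l2 + m1 := by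
    rw [Real.sqrt_lt' (by positivity)]
    nlinarith [mul_pos hl1 hm1]
  exact div_pos (sub_pos.2 hsqrt) (by positivity)

/-- The gap between the two kernel roots, scaled by `l1`, is the square root of the
discriminant. -/
theorem l1_mul_root_gap {l1 l2 m1 : ℝ} (hl1 : 0 < l1) (hl2 : 0 < l2) (hm1 : 0 < m1) :
    l1 * (1 / c0v l1 l2 m1 - c0v l1 l2 m1 / (l1 / m1)) =
      √((l1 + l2 + m1) ^ 2 - 4 * l1 * m1) := by
  have hc := c0v_pos hl1 hl2 hm1
  have hsq := Real.sq_sqrt (discriminant_pos hl1 hl2 hm1).le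
  have hdef : 2 * m1 * c0v l1 l2 m1 =
      l1 + l2 + m1 - √((l1 + l2 + m1) ^ 2 - 4 * l1 * m1) := by
    rw [c0v]
    field_simp
  generalize c0v l1 l2 m1 = c at *
  generalize √((l1 + l2 + m1) ^ 2 - 4 * l1 * m1) = s at *
  obtain rfl : s = l1 + l2 + m1 - 2 * m1 * c := by linarith
  field_simp
  have hroot : m1 * (m1 * c ^ 2 - (l1 + l2 + m1) * c + l1) = 0 := by linarith
  have := (mul_eq_zero.1 hroot).resolve_left hm1.ne'
  linarith

/-- The inductive asymptotic (47): for every `j`,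
`lim_{x→(1/c0)⁻} (1−c0·x)^{j+1}·ψ_j(x) = c0·L₀·(c1/c0)^j`. -/
theorem stmt10 (l1 l2 m1 : ℝ) (hl1 : 0 < l1) (hl2 : 0 < l2) (hm1 : 0 < m1)
    (c0 c1 x1 : ℝ) (hc0 : c0 = c0v l1 l2 m1) (hc1 : c1 = c1v l1 l2 m1)
    (hx1 : x1 = c0 / (l1 / m1))
    (L0 : ℝ) (psi : ℕ → ℝ → ℝ)
    (h0 : ∀ x ∈ Ico (0:ℝ) (1 / c0), psi 0 x = c0 * L0 / (1 - c0 * x))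
    (hrec : ∀ j : ℕ, ∃ aj : ℝ, ∀ x ∈ Ico (0:ℝ) (1 / c0), x ≠ x1 →
      psi (j + 1) x = aj / (1 - c0 * x)
        + l2 * c0 * x / (l1 * (1 - c0 * x)) * ((psi j x - psi j x1) / (x - x1))) :
    ∀ j : ℕ,
      Tendsto (fun x => (1 - c0 * x) ^ (j + 1) * psi j x) (𝓝[<] (1 / c0))
        (𝓝 (c0 * L0 * (c1 / c0) ^ j)) := by
  have hc0_pos : 0 < c0 := hc0 ▸ c0v_pos hl1 hl2 hm1
  have hs_pos := Real.sqrt_pos.2 (discriminant_pos hl1 hl2 hm1)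
  have hgap : l1 * (1 / c0 - x1) = √((l1 + l2 + m1) ^ 2 - 4 * l1 * m1) := by
    rw [hx1, hc0]
    exact l1_mul_root_gap hl1 hl2 hm1
  have hgap_pos : 0 < 1 / c0 - x1 := pos_of_mul_pos_right (hgap ▸ hs_pos) hl1.le
  have hratio : c1 / c0 = l2 / (l1 * (1 / c0 - x1)) := by
    rw [hgap, hc1, c1v, ← hc0]
    field_simp
  have hid : Tendsto (fun x : ℝ => x) (𝓝[<] (1 / c0)) (𝓝 (1 / c0)) := nhdsWithin_le_nhds
  have hfactor : Tendsto (fun x => 1 - c0 * x) (𝓝[<] (1 / c0)) (𝓝 0) := by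
    simpa [hc0_pos.ne'] using (hid.const_mul c0).const_sub 1
  have hpos : ∀ᶠ x in 𝓝[<] (1 / c0), 0 < x := hid.eventually_const_lt (by positivity)
  have hgt : ∀ᶠ x in 𝓝[<] (1 / c0), x1 < x := hid.eventually_const_lt (by linarith)
  have hfactor_ne : ∀ x < 1 / c0, 1 - c0 * x ≠ 0 := fun x hx => by
    rw [lt_div_iff₀ hc0_pos] at hx
    linarith
  intro j
  induction j with
  | zero =>
    refine (tendsto_const_nhds (x := c0 * L0)).congr' ?_ |>.trans (by simp)
    filter_upwards [hpos, self_mem_nhdsWithin] with x hx hlt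
    have := hfactor_ne x hlt
    rw [h0 x ⟨hx.le, hlt⟩, zero_add, pow_one]
    field_simp
  | succ j ih =>
    obtain ⟨a, ha⟩ := hrec j
    have hpow : Tendsto (fun x => (1 - c0 * x) ^ (j + 1)) (𝓝[<] (1 / c0)) (𝓝 0) := by
      simpa using hfactor.pow (j + 1)
    have hlim := (hpow.const_mul a).add
      (((hid.const_mul (l2 * c0)).div_const l1).mul
        ((ih.sub (hpow.mul_const (psi j x1))).div (hid.sub_const x1) hgap_pos.ne'))
    have hval : a * 0 + l2 * c0 * (1 / c0) / l1 *
        ((c0 * L0 * (c1 / c0) ^ j - 0 * psi j x1) / (1 / c0 - x1)) =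
        c0 * L0 * (c1 / c0) ^ (j + 1) := by
      rw [pow_succ, show l2 * c0 * (1 / c0) = l2 by field_simp]
      generalize (c1 / c0) ^ j = p
      rw [hratio]
      generalize 1 / c0 - x1 = g at *
      field_simp
      ring
    rw [hval] at hlim
    refine hlim.congr' ?_
    filter_upwards [hpos, hgt, self_mem_nhdsWithin] with x hx hx1x hlt
    have hne := hfactor_ne x hlt
    have hsub : x - x1 ≠ 0 := (sub_pos.2 hx1x).ne'
    rw [ha x ⟨hx.le, hlt⟩ hx1x.ne', pow_succ _ (j + 1)]
    simp only [Pi.div_apply]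
    generalize (1 - c0 * x) ^ (j + 1) = p
    field_simp

end
end

section
/- Let λ1, λ2, μ1, μ2 > 0 with λ1+λ2+μ1+μ2 = 1. Then for every real y with Δ(y) ≥ 0: T(y)·T*(y) = 4·μ2²·(1−y)·(1−η1·y)·(1−η2·y). -/
open Real Filter Topology Set

noncomputable section

/-- The radicand of `η1` and `η2` is nonnegative. -/
theorem eta_radicand_nonneg (l1 l2 m1 m2 : ℝ) (hl1 : 0 < l1) (hl2 : 0 < l2)
    (hsum : l1 + l2 + m1 + m2 = 1) :
    0 ≤ (1 - 2 * m1) ^ 2 + 4 * (m1 - m2) * l2 := by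
  rcases le_total m2 m1 with h | h
  · have := mul_nonneg (sub_nonneg.2 h) hl2.le
    nlinarith [sq_nonneg (1 - 2 * m1)]
  · obtain rfl : l1 = 1 - l2 - m1 - m2 := by linarith
    nlinarith [mul_pos hl1 hl2, mul_nonneg hl1.le (sub_nonneg.2 h),
      sq_nonneg (l2 - (m2 - m1)), sq_nonneg (1 - l2 - m1 - m2)]

/-- The quadratic with reciprocal roots `η1` and `η2`. -/
theorem eta_factorization (l2 m1 m2 y : ℝ) (hm2 : m2 ≠ 0)
    (h : 0 ≤ (1 - 2 * m1) ^ 2 + 4 * (m1 - m2) * l2) :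
    m2 * ((1 - eta1 l2 m1 m2 * y) * (1 - eta2 l2 m1 m2 * y))
      = m2 - (1 - 2 * m1) * y - (m1 - m2) * l2 / m2 * y ^ 2 := by
  have hs := Real.sq_sqrt h
  unfold eta1 eta2
  field_simp
  linear_combination (-y ^ 2) * hs

/-- The factorization `T(y)·T*(y) = 4·μ2²·(1−y)·(1−η1·y)·(1−η2·y)`. -/
theorem stmt12 (l1 l2 m1 m2 : ℝ) (hl1 : 0 < l1) (hl2 : 0 < l2) (hm1 : 0 < m1) (hm2 : 0 < m2)
    (hsum : l1 + l2 + m1 + m2 = 1) :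
    ∀ y : ℝ, 0 ≤ Delta l1 l2 m1 y →
      Tm l1 l2 m1 m2 y * Tstar l1 l2 m1 m2 y
        = 4 * m2 ^ 2 * (1 - y) * (1 - eta1 l2 m1 m2 * y) * (1 - eta2 l2 m1 m2 * y) := by
  intro y hy
  have hd := Real.sq_sqrt hy
  have he := eta_factorization l2 m1 m2 y hm2.ne'
    (eta_radicand_nonneg l1 l2 m1 m2 hl1 hl2 hsum)
  have hdiv : m2 * ((m1 - m2) * l2 / m2) = (m1 - m2) * l2 := mul_div_cancel₀ _ hm2.ne'
  obtain rfl : l1 = 1 - l2 - m1 - m2 := by linarith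
  unfold Tm Tstar Ff
  unfold Delta at hd ⊢
  linear_combination (-y ^ 2) * hd - 4 * m2 * (1 - y) * he + 4 * (1 - y) * y ^ 2 * hdiv

end
end
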